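/- arXiv:1911.07473 — 2 statements merged into one kernel-verified Lean document; each statement's English description precedes it below -/
import Mathlib

section
/- For every natural number m and every real number t ≠ 0, the two terminating hypergeometric sums satisfy Σ_{j=0}^{m} [(m)_j(−m)_j / ((1/2)_j · j!)] · (1 − t²)^j = t^{2m} · Σ_{n=0}^{m} [(−m)_n(1/2 − m)_n / ((1/2)_n · n!)] · (1 − 1/t²)^n. (This is the identity behind part iv) of Proposition 2.3 for integer |k| = m, expressing the wave kernel as a finite sum.) -/
open scoped Nat

/-- The Pochhammer symbol (ascending factorial) `(a)_n` for a real number `a`. -/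
noncomputable def poch (a : ℝ) (n : ℕ) : ℝ := (ascPochhammer ℝ n).eval a

theorem poch_zero (a : ℝ) : poch a 0 = 1 := by simp [poch]

theorem poch_succ (a : ℝ) (n : ℕ) : poch a (n + 1) = poch a n * (a + n) := by
  simp [poch, ascPochhammer_succ_eval]

theorem poch_succ_left (a : ℝ) (n : ℕ) : poch a (n + 1) = a * poch (a + 1) n := by
  induction n with
  | zero => simp [poch_succ, poch_zero]
  | succ n ih => rw [poch_succ, ih, poch_succ (a + 1)]; push_cast; ring

theorem poch_half_pos (n : ℕ) : 0 < poch (1 / 2) n := by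
  induction n with
  | zero => simp [poch_zero]
  | succ n ih => rw [poch_succ]; positivity

theorem poch_neg_zero (m j : ℕ) (h : m < j) : poch (-(m : ℝ)) j = 0 := by
  induction j with
  | zero => omega
  | succ j ih =>
    rw [poch_succ]
    rcases Nat.lt_or_ge m j with h' | h'
    · rw [ih h']; ring
    · have : m = j := by omega
      subst this; ring

noncomputable def pfA (M : ℝ) (j : ℕ) : ℝ := poch M j * poch (-M) j / (poch (1 / 2) j * j !)

theorem pfA_rec (M : ℝ) (j : ℕ) :
    pfA (M + 2) (j + 1) = 2 * pfA (M + 1) (j + 1) - pfA M (j + 1) - 4 * pfA (M + 1) j := by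
  cases j with
  | zero => simp [pfA, poch_succ, poch_zero]; ring
  | succ k =>
    have e1 : poch (M + 2) (k + 2) = poch (M + 2) k * (M + 2 + k) * (M + 3 + k) := by
      rw [poch_succ, poch_succ]; push_cast; ring
    have e2 : poch (M + 1) (k + 2) = (M + 1) * poch (M + 2) k * (M + 2 + k) := by
      rw [poch_succ_left, poch_succ, show M + 1 + 1 = M + 2 by ring]; ring
    have e3 : poch M (k + 2) = M * (M + 1) * poch (M + 2) k := by
      rw [poch_succ_left, poch_succ_left, show M + 1 + 1 = M + 2 by ring]; ring
    have e4 : poch (M + 1) (k + 1) = (M + 1) * poch (M + 2) k := by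
      rw [poch_succ_left, show M + 1 + 1 = M + 2 by ring]
    have f1 : poch (-(M + 2)) (k + 2) = (-M - 2) * (-M - 1) * poch (-M) k := by
      rw [poch_succ_left, poch_succ_left, show -(M + 2) + 1 + 1 = -M by ring]; ring
    have f2 : poch (-(M + 1)) (k + 2) = (-M - 1) * poch (-M) k * (-M + k) := by
      rw [poch_succ_left, poch_succ, show -(M + 1) + 1 = -M by ring]; ring
    have f3 : poch (-M) (k + 2) = poch (-M) k * (-M + k) * (-M + k + 1) := by
      rw [poch_succ, poch_succ]; push_cast; ring
    have f4 : poch (-(M + 1)) (k + 1) = (-M - 1) * poch (-M) k := by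
      rw [poch_succ_left, show -(M + 1) + 1 = -M by ring]; ring
    have hD := (poch_half_pos (k + 1)).ne'
    have hF : (((k + 1)! : ℕ) : ℝ) ≠ 0 := by positivity
    have hk : (1 / 2 + ((k + 1 : ℕ) : ℝ)) ≠ 0 := by positivity
    have hk2 : (((k + 1 + 1 : ℕ)) : ℝ) ≠ 0 := by positivity
    have key : ∀ a b : ℝ, a / (poch (1 / 2) (k + 1) * (k + 1)!) =
        a * ((1 / 2 + ((k + 1 : ℕ) : ℝ)) * ((k + 1 + 1 : ℕ) : ℝ)) /
        (poch (1 / 2) (k + 1 + 1) * (k + 1 + 1)!) := by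
      intro a b
      rw [poch_succ (1 / 2) (k + 1), Nat.factorial_succ (k + 1)]
      rw [Nat.cast_mul]
      field_simp
    unfold pfA
    rw [key _ 0, e1, e2, e3, e4, f1, f2, f3, f4]
    push_cast
    ring

theorem pfA_zero (m j : ℕ) (h : m < j) : pfA m j = 0 := by
  simp [pfA, poch_neg_zero m j h]

noncomputable def pfF (m : ℕ) (x : ℝ) : ℝ := ∑ j ∈ Finset.range (m + 1), pfA m j * x ^ j

theorem pfF_ext (m N : ℕ) (x : ℝ) (h : m ≤ N) :
    pfF m x = ∑ j ∈ Finset.range (N + 1), pfA m j * x ^ j := by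
  unfold pfF
  apply Finset.sum_subset
  · intro i; simp; omega
  · intro i _ hi
    rw [pfA_zero m i (by simpa using hi)]; ring

theorem pfF_rec (m : ℕ) (x : ℝ) :
    pfF (m + 2) x = 2 * (1 - 2 * x) * pfF (m + 1) x - pfF m x := by
  have h0 : ∀ M, pfA M 0 = 1 := by intro M; simp [pfA, poch_zero]
  have e3 : pfF (m + 1) x = ∑ j ∈ Finset.range (m + 2), pfA ((m : ℝ) + 1) j * x ^ j := by
    simp [pfF]
  have e : 2 * (1 - 2 * x) * pfF (m + 1) x = 2 * pfF (m + 1) x - 4 * x * pfF (m + 1) x := by ring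
  rw [e]
  nth_rewrite 2 [e3]
  rw [pfF_ext m (m + 2) x (by omega), pfF_ext (m + 1) (m + 2) x (by omega),
    pfF_ext (m + 2) (m + 2) x le_rfl, Finset.sum_range_succ' _ (m + 2),
    Finset.sum_range_succ' _ (m + 2), Finset.sum_range_succ' _ (m + 2), h0, h0, h0]
  push_cast
  simp only [pfA_rec]
  have : ∀ j, (2 * pfA ((m : ℝ) + 1) (j + 1) - pfA m (j + 1) - 4 * pfA ((m : ℝ) + 1) j) * x ^ (j + 1)
      = 2 * (pfA ((m : ℝ) + 1) (j + 1) * x ^ (j + 1)) - pfA m (j + 1) * x ^ (j + 1)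
        - 4 * x * (pfA ((m : ℝ) + 1) j * x ^ j) := by intro j; ring
  simp only [this, Finset.sum_sub_distrib, ← Finset.mul_sum]
  ring

noncomputable def pfP (m : ℕ) (y : ℝ) : ℝ :=
  ∑ n ∈ Finset.range (m + 1), ((2 * m).choose (2 * n) : ℝ) * y ^ n
noncomputable def pfQ (m : ℕ) (y : ℝ) : ℝ :=
  ∑ n ∈ Finset.range (m + 1), ((2 * m).choose (2 * n + 1) : ℝ) * y ^ n

theorem choose_two (a b : ℕ) : ((a + 2).choose (b + 2) : ℝ) =
    a.choose (b + 2) + 2 * a.choose (b + 1) + a.choose b := by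
  rw [Nat.choose_succ_succ' (a + 1), Nat.choose_succ_succ' a, Nat.choose_succ_succ' a]
  push_cast; ring

theorem pfP_rec (m : ℕ) (y : ℝ) : pfP (m + 1) y = (1 + y) * pfP m y + 2 * y * pfQ m y := by
  have e : pfP m y = ∑ n ∈ Finset.range (m + 2), ((2 * m).choose (2 * n) : ℝ) * y ^ n := by
    rw [Finset.sum_range_succ, Nat.choose_eq_zero_of_lt (by omega : 2 * m < 2 * (m + 1))]
    simp [pfP]
  have e' : (1 + y) * pfP m y = pfP m y + y * pfP m y := by ring
  rw [e']
  nth_rewrite 1 [e]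
  unfold pfP pfQ
  rw [Finset.sum_range_succ' _ (m + 1), Finset.sum_range_succ' _ (m + 1)]
  have : ∀ n, ((2 * (m + 1)).choose (2 * (n + 1)) : ℝ) * y ^ (n + 1) =
      ((2 * m).choose (2 * (n + 1)) : ℝ) * y ^ (n + 1)
      + 2 * y * (((2 * m).choose (2 * n + 1) : ℝ) * y ^ n)
      + y * (((2 * m).choose (2 * n) : ℝ) * y ^ n) := by
    intro n
    rw [show 2 * (m + 1) = 2 * m + 2 by ring, show 2 * (n + 1) = 2 * n + 2 by ring, choose_two]
    ring
  simp only [this, Finset.sum_add_distrib, ← Finset.mul_sum]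
  simp
  ring

theorem pfQ_rec (m : ℕ) (y : ℝ) : pfQ (m + 1) y = (1 + y) * pfQ m y + 2 * pfP m y := by
  have e : pfQ m y = ∑ n ∈ Finset.range (m + 2), ((2 * m).choose (2 * n + 1) : ℝ) * y ^ n := by
    rw [Finset.sum_range_succ, Nat.choose_eq_zero_of_lt (by omega : 2 * m < 2 * (m + 1) + 1)]
    simp [pfQ]
  have e2 : pfP m y = ∑ n ∈ Finset.range (m + 2), ((2 * m).choose (2 * n) : ℝ) * y ^ n := by
    rw [Finset.sum_range_succ, Nat.choose_eq_zero_of_lt (by omega : 2 * m < 2 * (m + 1))]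
    simp [pfP]
  have e' : (1 + y) * pfQ m y = pfQ m y + y * pfQ m y := by ring
  rw [e', e2]
  nth_rewrite 1 [e]
  unfold pfQ
  rw [Finset.sum_range_succ' _ (m + 1), Finset.sum_range_succ' _ (m + 1),
    Finset.sum_range_succ' _ (m + 1)]
  have : ∀ n, ((2 * (m + 1)).choose (2 * (n + 1) + 1) : ℝ) * y ^ (n + 1) =
      ((2 * m).choose (2 * (n + 1) + 1) : ℝ) * y ^ (n + 1)
      + 2 * (((2 * m).choose (2 * (n + 1)) : ℝ) * y ^ (n + 1))
      + y * (((2 * m).choose (2 * n + 1) : ℝ) * y ^ n) := by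
    intro n
    rw [show 2 * (m + 1) = 2 * m + 2 by ring, show 2 * (n + 1) + 1 = (2 * n + 1) + 2 by ring,
      choose_two, show 2 * (n + 1) = 2 * n + 1 + 1 by ring]
    ring
  simp only [this, Finset.sum_add_distrib, ← Finset.mul_sum]
  simp
  ring

theorem pfP_rec2 (m : ℕ) (y : ℝ) :
    pfP (m + 2) y = 2 * (1 + y) * pfP (m + 1) y - (1 - y) ^ 2 * pfP m y := by
  rw [pfP_rec (m + 1), pfQ_rec, pfP_rec m]; ring

theorem choose_step (N k : ℕ) :
    (N.choose (k + 1) : ℝ) * (k + 1) = N.choose k * ((N : ℝ) - k) := by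
  rcases Nat.lt_or_ge N k with h | h
  · rw [Nat.choose_eq_zero_of_lt h, Nat.choose_eq_zero_of_lt (by omega : N < k + 1)]; simp
  · have := Nat.choose_succ_right_eq N k
    rw [← Nat.cast_sub h]; exact_mod_cast this

theorem pf_coeff (m n : ℕ) :
    poch (-(m : ℝ)) n * poch (1 / 2 - m) n / (poch (1 / 2) n * n !) =
      ((2 * m).choose (2 * n) : ℝ) := by
  induction n with
  | zero => simp [poch_zero]
  | succ n ih =>
    have hD := (poch_half_pos n).ne'
    have hF : ((n ! : ℕ) : ℝ) ≠ 0 := by positivity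
    have hk : (1 / 2 + (n : ℝ)) ≠ 0 := by positivity
    have hk2 : ((n : ℝ) + 1) ≠ 0 := by positivity
    have c1 := choose_step (2 * m) (2 * n)
    have c2 := choose_step (2 * m) (2 * n + 1)
    rw [div_eq_iff (by positivity)] at ih
    have hp := poch_half_pos (n + 1)
    rw [div_eq_iff (by positivity), poch_succ, poch_succ, poch_succ, Nat.factorial_succ,
      show 2 * (n + 1) = 2 * n + 1 + 1 by ring]
    push_cast at c1 c2 ⊢
    linear_combination (-(m : ℝ) + n) * (1 / 2 - m + n) * ih
      - poch (1 / 2) n * n ! * (((2 * m : ℝ) - (2 * n + 1)) / 4 * c1 + (2 * n + 1) / 4 * c2)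

theorem pf_main (t : ℝ) (ht : t ≠ 0) (m : ℕ) :
    pfF m (1 - t ^ 2) = t ^ (2 * m) * pfP m (1 - 1 / t ^ 2) := by
  induction m using Nat.twoStepInduction with
  | zero => simp [pfF, pfP, pfA, poch_zero]
  | one =>
    simp [pfF, pfP, pfA, poch_zero, poch_succ, Finset.sum_range_succ]
    field_simp
    ring
  | more m h1 h2 =>
    rw [pfF_rec, h1, h2, pfP_rec2]
    generalize pfP (m + 1) _ = p
    generalize pfP m _ = q
    field_simp
    ring

/-- The terminating form of the Pfaff transformation for integer parameter `m`:
`F(m, −m; 1/2; 1−t²) = t^{2m} F(−m, 1/2−m; 1/2; 1 − 1/t²)` for all real `t ≠ 0`. -/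
theorem terminating_pfaff_transformation (m : ℕ) (t : ℝ) (ht : t ≠ 0) :
    ∑ j ∈ Finset.range (m + 1),
        poch (m : ℝ) j * poch (-(m : ℝ)) j / (poch (1 / 2) j * j !) * (1 - t ^ 2) ^ j =
      t ^ (2 * m) *
        ∑ n ∈ Finset.range (m + 1),
          poch (-(m : ℝ)) n * poch (1 / 2 - m) n / (poch (1 / 2) n * n !) *
            (1 - 1 / t ^ 2) ^ n := by
  simp only [pf_coeff]
  exact pf_main t ht m
end

section
/- For every real ν ≥ 0 and every real z > 0, Kummer's formula holds: Σ_{n=0}^∞ [(ν + 1/2)_n / ((2ν + 1)_n · n!)] · (2iz)^n = Γ(1 + ν) · e^{iz} · (z/2)^{−ν} · Σ_{m=0}^∞ [(−1)^m / (m! · Γ(m + ν + 1))] · (z/2)^{2m + ν}; that is, ₁F₁(ν + 1/2; 2ν + 1; 2iz) = Γ(1+ν) e^{iz} (z/2)^{−ν} J_ν(z). -/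
open scoped Nat

/-- The Pochhammer symbol (ascending factorial) `(a)_n` for a complex number `a`. -/
noncomputable def cpoch (a : ℂ) (n : ℕ) : ℂ := (ascPochhammer ℂ n).eval a

/-- Coefficients of the normalized Bessel series. -/
noncomputable def kbG (ν : ℝ) : ℕ → ℝ
  | 0 => 1
  | 1 => 0
  | (j + 2) => kbG ν j / (((j : ℝ) + 2) * ((j : ℝ) + 2 + 2 * ν))

lemma kbG_nonneg (ν : ℝ) (hν : 0 ≤ ν) : ∀ j, 0 ≤ kbG ν j ∧ kbG ν j ≤ 1 / (j ! : ℝ)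
  | 0 => by simp [kbG]
  | 1 => by simp [kbG]
  | (j + 2) => by
    obtain ⟨h0, h1⟩ := kbG_nonneg ν hν j
    have hj : (0 : ℝ) ≤ j := Nat.cast_nonneg j
    rw [kbG]
    refine ⟨by positivity, ?_⟩
    have e : (1 : ℝ) / ((j + 2)! : ℕ) = (1 / (j ! : ℝ)) / (((j : ℝ) + 2) * ((j : ℝ) + 1)) := by
      rw [Nat.factorial_succ, Nat.factorial_succ]
      push_cast
      field_simp
      ring
    rw [e]
    have hle : (j : ℝ) + 1 ≤ (j : ℝ) + 2 + 2 * ν := by linarith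
    refine div_le_div₀ (by positivity) h1 (by positivity) ?_
    exact mul_le_mul_of_nonneg_left hle (by positivity)

lemma kbG_odd (ν : ℝ) (m : ℕ) : kbG ν (2 * m + 1) = 0 := by
  induction m with
  | zero => simp [kbG]
  | succ m ih =>
    rw [show 2 * (m + 1) + 1 = (2 * m + 1) + 2 by ring, kbG, ih]
    simp

lemma kbG_even (ν : ℝ) (hν : 0 ≤ ν) (m : ℕ) :
    kbG ν (2 * m) = Real.Gamma (1 + ν) / (4 ^ m * m ! * Real.Gamma (m + ν + 1)) := by
  induction m with
  | zero =>
    have : Real.Gamma (1 + ν) ≠ 0 := (Real.Gamma_pos_of_pos (by linarith)).ne'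
    simp [kbG, add_comm ν 1, this]
  | succ m ih =>
    have hm : (0 : ℝ) ≤ m := Nat.cast_nonneg m
    have h1 : Real.Gamma (m + ν + 1) ≠ 0 := (Real.Gamma_pos_of_pos (by linarith)).ne'
    have h3 : (m + ν + 1) ≠ 0 := by positivity
    have h2 : Real.Gamma (((m + 1 : ℕ) : ℝ) + ν + 1) = (m + ν + 1) * Real.Gamma (m + ν + 1) := by
      rw [← Real.Gamma_add_one h3]
      push_cast
      ring_nf
    rw [show 2 * (m + 1) = (2 * m) + 2 by ring, kbG, ih, h2, Nat.factorial_succ]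
    push_cast
    have h4 : (2 * (m : ℝ) + 2 + 2 * ν) = 2 * (m + ν + 1) := by ring
    have h5 : (2 * (m : ℝ) + 2) = 2 * (m + 1) := by ring
    rw [h4, h5, pow_succ]
    field_simp
    ring

/-- The product power series. -/
noncomputable def kbY (ν : ℝ) : PowerSeries ℝ :=
  PowerSeries.exp ℝ * PowerSeries.mk (kbG ν)

lemma kbG_ode (ν a : ℝ) (hν : 0 ≤ ν) (ha : a = 2 * ν + 1) :
    PowerSeries.X * PowerSeries.derivative ℝ (PowerSeries.derivative ℝ (PowerSeries.mk (kbG ν)))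
      + PowerSeries.C a * PowerSeries.derivative ℝ (PowerSeries.mk (kbG ν))
      = PowerSeries.X * PowerSeries.mk (kbG ν) := by
  ext n
  cases n with
  | zero =>
    simp only [map_add, PowerSeries.coeff_zero_X_mul, PowerSeries.coeff_C_mul,
      PowerSeries.coeff_derivative, PowerSeries.coeff_mk]
    simp [kbG]
  | succ n =>
    have hn : (0 : ℝ) ≤ n := Nat.cast_nonneg n
    simp only [map_add, PowerSeries.coeff_succ_X_mul, PowerSeries.coeff_C_mul,
      PowerSeries.coeff_derivative, PowerSeries.coeff_mk]
    rw [kbG]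
    have : (n : ℝ) + 2 + 2 * ν ≠ 0 := by positivity
    subst ha
    push_cast
    field_simp
    ring

lemma kbY_rec (ν : ℝ) (hν : 0 ≤ ν) (n : ℕ) :
    ((n : ℝ) + 1) * (n + 2 * ν + 1) * PowerSeries.coeff (n + 1) (kbY ν)
      = (2 * n + 2 * ν + 1) * PowerSeries.coeff n (kbY ν) := by
  obtain ⟨a, ha⟩ : ∃ a, a = 2 * ν + 1 := ⟨_, rfl⟩
  have hE : PowerSeries.derivative ℝ (PowerSeries.exp ℝ) = PowerSeries.exp ℝ := by
    ext n
    simp [PowerSeries.coeff_derivative, PowerSeries.coeff_exp, Nat.factorial_succ]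
    field_simp
  have key : PowerSeries.X * PowerSeries.derivative ℝ (PowerSeries.derivative ℝ (kbY ν))
      + PowerSeries.C a * PowerSeries.derivative ℝ (kbY ν)
      = PowerSeries.X * PowerSeries.derivative ℝ (kbY ν)
        + PowerSeries.X * PowerSeries.derivative ℝ (kbY ν)
        + PowerSeries.C a * kbY ν := by
    have h := kbG_ode ν a hν ha
    simp only [kbY, Derivation.leibniz, map_add, smul_eq_mul, hE]
    linear_combination PowerSeries.exp ℝ * h
  have := congrArg (PowerSeries.coeff n) key
  cases n with
  | zero =>
    simp only [map_add, PowerSeries.coeff_zero_X_mul, PowerSeries.coeff_C_mul,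
      PowerSeries.coeff_derivative] at this
    subst ha
    push_cast at this ⊢
    linear_combination this
  | succ n =>
    simp only [map_add, PowerSeries.coeff_succ_X_mul, PowerSeries.coeff_C_mul,
      PowerSeries.coeff_derivative] at this
    subst ha
    push_cast at this ⊢
    linear_combination this

lemma cpoch_succ (a : ℂ) (n : ℕ) : cpoch a (n + 1) = cpoch a n * (a + n) := by
  simp [cpoch, ascPochhammer_succ_right]

lemma cpoch_ne (ν : ℝ) (hν : 0 ≤ ν) (n : ℕ) : cpoch (2 * (ν : ℂ) + 1) n ≠ 0 := by
  induction n with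
  | zero => simp [cpoch]
  | succ n ih =>
    rw [cpoch_succ]
    refine mul_ne_zero ih ?_
    have : (2 * ν + 1 + n : ℝ) ≠ 0 := by positivity
    exact_mod_cast this

lemma kbY_coeff (ν : ℝ) (hν : 0 ≤ ν) (n : ℕ) :
    ((PowerSeries.coeff n (kbY ν) : ℝ) : ℂ) =
      cpoch ((ν : ℂ) + 1 / 2) n / (cpoch (2 * (ν : ℂ) + 1) n * (n ! : ℂ)) * 2 ^ n := by
  induction n with
  | zero => simp [cpoch, kbY, kbG]
  | succ n ih =>
    have h := congrArg (fun x : ℝ => (x : ℂ)) (kbY_rec ν hν n)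
    push_cast at h
    rw [ih] at h
    have h1 := cpoch_ne ν hν n
    have h2 : (2 * (ν : ℂ) + 1 + n) ≠ 0 := by
      have : (2 * ν + 1 + n : ℝ) ≠ 0 := by positivity
      exact_mod_cast this
    have h3 : ((n : ℂ) + 1) ≠ 0 := Nat.cast_add_one_ne_zero n
    have h4 : (n ! : ℂ) ≠ 0 := by exact_mod_cast n.factorial_ne_zero
    have h5 : ((n : ℂ) + 1) * (n + 2 * ν + 1) ≠ 0 :=
      mul_ne_zero h3 (by convert h2 using 1; ring)
    apply mul_left_cancel₀ h5
    rw [h, cpoch_succ, cpoch_succ, Nat.factorial_succ]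
    push_cast
    rw [pow_succ]
    field_simp
    ring

lemma kb_main (ν : ℝ) (hν : 0 ≤ ν) (w : ℂ) :
    ∑' n : ℕ, ((PowerSeries.coeff n (kbY ν) : ℝ) : ℂ) * w ^ n
      = Complex.exp w * ∑' j : ℕ, (kbG ν j : ℂ) * w ^ j := by
  have hs1 : Summable fun n : ℕ => ‖w ^ n / (n ! : ℂ)‖ :=
    NormedSpace.norm_expSeries_div_summable w
  have hs2 : Summable fun n : ℕ => ‖(kbG ν n : ℂ) * w ^ n‖ := by
    refine Summable.of_nonneg_of_le (fun _ => norm_nonneg _) (fun n => ?_) hs1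
    obtain ⟨h0, h1⟩ := kbG_nonneg ν hν n
    rw [norm_mul, norm_div, Complex.norm_real, Real.norm_of_nonneg h0, Complex.norm_natCast,
      div_eq_mul_one_div, mul_comm]
    gcongr
  rw [Complex.exp_eq_exp_ℂ, NormedSpace.exp_eq_tsum_div,
    tsum_mul_tsum_eq_tsum_sum_antidiagonal_of_summable_norm hs1 hs2]
  refine tsum_congr fun n => ?_
  rw [kbY, PowerSeries.coeff_mul]
  push_cast
  rw [Finset.sum_mul]
  refine Finset.sum_congr rfl fun p hp => ?_
  rw [← Finset.HasAntidiagonal.mem_antidiagonal.mp hp, pow_add]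
  simp [PowerSeries.coeff_exp]
  ring

/-- Kummer's formula `₁F₁(ν + 1/2; 2ν + 1; 2iz) = Γ(1+ν) e^{iz} (z/2)^{−ν} J_ν(z)`
for real `ν ≥ 0` and real `z > 0`. -/
theorem kummer_bessel_formula (ν z : ℝ) (hν : 0 ≤ ν) (hz : 0 < z) :
    ∑' n : ℕ,
        cpoch ((ν : ℂ) + 1 / 2) n / (cpoch (2 * (ν : ℂ) + 1) n * (n ! : ℂ)) *
          (2 * Complex.I * (z : ℂ)) ^ n =
      (Real.Gamma (1 + ν) : ℂ) * Complex.exp (Complex.I * (z : ℂ)) *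
        (((z / 2) ^ (-ν) : ℝ) : ℂ) *
        ((∑' m : ℕ,
          (-1 : ℝ) ^ m / (m ! * Real.Gamma (m + ν + 1)) *
            (z / 2) ^ (2 * (m : ℝ) + ν) : ℝ) : ℂ) := by
  have hl : ∀ n : ℕ, cpoch ((ν : ℂ) + 1 / 2) n / (cpoch (2 * (ν : ℂ) + 1) n * (n ! : ℂ)) *
      (2 * Complex.I * (z : ℂ)) ^ n
      = ((PowerSeries.coeff n (kbY ν) : ℝ) : ℂ) * (Complex.I * z) ^ n := fun n => by
    rw [kbY_coeff ν hν, mul_assoc 2, mul_pow 2]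
    ring
  rw [tsum_congr hl, kb_main ν hν]
  have hinj : Function.Injective (fun m : ℕ => 2 * m) := fun a b h => by
    simpa using h
  have hsupp : Function.support (fun j : ℕ => (kbG ν j : ℂ) * (Complex.I * z) ^ j)
      ⊆ Set.range (fun m : ℕ => 2 * m) := by
    intro j hj
    rcases Nat.even_or_odd' j with ⟨m, rfl | rfl⟩
    · exact ⟨m, rfl⟩
    · exact absurd (by simp [kbG_odd]) hj
  rw [← hinj.tsum_eq hsupp, Complex.ofReal_tsum]
  have hre : ∀ g e p t : ℂ, g * e * p * t = e * ((g * p) * t) := fun g e p t => by ring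
  rw [hre, ← tsum_mul_left (a := (Real.Gamma (1 + ν) : ℂ) * (((z / 2) ^ (-ν) : ℝ) : ℂ))]
  refine congrArg (fun t => Complex.exp (Complex.I * (z : ℂ)) * t) ?_
  refine tsum_congr fun m => ?_
  have hz2 : 0 < z / 2 := by positivity
  have e1 : (z / 2) ^ (2 * (m : ℝ) + ν) = (z / 2) ^ (2 * m) * (z / 2) ^ ν := by
    rw [Real.rpow_add hz2, ← Real.rpow_natCast]
    push_cast
    rfl
  have e2 : (Complex.I * (z : ℂ)) ^ (2 * m) = (((-1) ^ m * z ^ (2 * m) : ℝ) : ℂ) := by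
    rw [mul_pow, pow_mul Complex.I, Complex.I_sq]
    push_cast
    rfl
  rw [e2, kbG_even ν hν, e1, Real.rpow_neg hz2.le]
  rw [← Complex.ofReal_mul, ← Complex.ofReal_mul, ← Complex.ofReal_mul, Complex.ofReal_inj]
  have h1 : (z / 2) ^ ν ≠ 0 := (Real.rpow_pos_of_pos hz2 ν).ne'
  have h2 : Real.Gamma (m + ν + 1) ≠ 0 := (Real.Gamma_pos_of_pos (by positivity)).ne'
  have h4 : (4 : ℝ) ^ m = 2 ^ (2 * m) := by rw [pow_mul]; norm_num
  rw [div_pow z 2, h4]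
  generalize (z / 2) ^ ν = q at *
  field_simp
end
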